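/- Let 𝒫 be a countable collection of seminorms on L¹, each lower semicontinuous with respect to L¹-norm convergence and each satisfying (1/c)·E|ξ| ≤ p(ξ) for all ξ ∈ L¹ for some constant c > 0 (possibly depending on p). Then the space Ỹ := ⋂_{p∈𝒫} dom p is sequentially complete for the family 𝒫: whenever a sequence (ξ^ν) in Ỹ satisfies p(ξ^ν − ξ^μ) → 0 as ν, μ → ∞ for every p ∈ 𝒫, there exists ξ ∈ Ỹ such that p(ξ^ν − ξ) → 0 for every p ∈ 𝒫. -/

import Mathlib

open MeasureTheory Filter Topology ENNReal

/-- For a countable collection `𝒫 = {p n}` of seminorms on `L¹`, each lower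
semicontinuous w.r.t. `L¹` convergence and dominating `(1/c)·E|ξ|`, the space
`Ỹ = ⋂ dom (p n)` is sequentially complete for the family: every sequence in `Ỹ` that is
Cauchy w.r.t. each `p n` converges in each `p n` to some element of `Ỹ`. -/
theorem optional_projection_duality_stmt1
    {Ω : Type*} [MeasurableSpace Ω] {μ : Measure Ω} [IsProbabilityMeasure μ]
    (p : ℕ → Lp ℝ 1 μ → ℝ≥0∞)
    (hp_zero : ∀ n, p n 0 = 0)
    (hp_hom : ∀ n (c : ℝ) (ξ : Lp ℝ 1 μ), p n (c • ξ) = ENNReal.ofReal |c| * p n ξ)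
    (hp_sub : ∀ n (ξ ζ : Lp ℝ 1 μ), p n (ξ + ζ) ≤ p n ξ + p n ζ)
    -- lower semicontinuity with respect to L¹-norm convergence
    (hp_lsc : ∀ n (ζ : ℕ → Lp ℝ 1 μ) (ζ' : Lp ℝ 1 μ), Tendsto ζ atTop (𝓝 ζ') →
      p n ζ' ≤ liminf (fun k => p n (ζ k)) atTop)
    -- (1/c)·E|ξ| ≤ p(ξ) for some c > 0
    (hp_lb : ∀ n, ∃ c : ℝ, 0 < c ∧ ∀ ξ : Lp ℝ 1 μ,
      (∫⁻ ω, ENNReal.ofReal |ξ ω| ∂μ) ≤ ENNReal.ofReal c * p n ξ)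
    -- a sequence in Ỹ = ⋂ dom (p n) ...
    (ξ : ℕ → Lp ℝ 1 μ) (hmem : ∀ ν n, p n (ξ ν) < ⊤)
    -- ... that is Cauchy for each seminorm: p n (ξ ν − ξ μ) → 0 as ν, μ → ∞
    (hcauchy : ∀ n, Tendsto (fun νμ : ℕ × ℕ => p n (ξ νμ.1 - ξ νμ.2)) atTop (𝓝 0)) :
    ∃ ξ' : Lp ℝ 1 μ, (∀ n, p n ξ' < ⊤) ∧
      ∀ n, Tendsto (fun ν => p n (ξ ν - ξ')) atTop (𝓝 0) := by
  have hc (n : ℕ) (ε : ℝ≥0∞) (hε : 0 < ε) :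
      ∃ N, ∀ k ≥ N, ∀ l ≥ N, p n (ξ k - ξ l) ≤ ε := by
    obtain ⟨N, hN⟩ := eventually_atTop_prod_self'.1 ((hcauchy n).eventually (eventually_le_nhds hε))
    exact ⟨N, hN⟩
  have hξ : CauchySeq ξ := by
    obtain ⟨c, -, hc'⟩ := hp_lb 0
    have hlim : Tendsto (fun q : ℕ × ℕ => ENNReal.ofReal c * p 0 (ξ q.1 - ξ q.2)) atTop (𝓝 0) := by
      simpa using ENNReal.Tendsto.const_mul (hcauchy 0) (Or.inr ENNReal.ofReal_ne_top)
    rw [EMetric.cauchySeq_iff]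
    intro ε hε
    obtain ⟨N, hN⟩ := eventually_atTop_prod_self'.1 (hlim.eventually (eventually_lt_nhds hε))
    refine ⟨N, fun k hk l hl => lt_of_le_of_lt ?_ (hN k hk l hl)⟩
    calc edist (ξ k) (ξ l) = ∫⁻ ω, ENNReal.ofReal |(ξ k - ξ l) ω| ∂μ := by
          rw [edist_eq_enorm_sub, Lp.enorm_def, eLpNorm_one_eq_lintegral_enorm]
          simp only [← Real.norm_eq_abs, ofReal_norm]
      _ ≤ _ := hc' _
  obtain ⟨ξ', hξ'⟩ := cauchySeq_tendsto_of_complete hξ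
  have hle (n : ℕ) (ε : ℝ≥0∞) (hε : 0 < ε) : ∃ N, ∀ k ≥ N, p n (ξ k - ξ') ≤ ε := by
    obtain ⟨N, hN⟩ := hc n ε hε
    refine ⟨N, fun k hk => (hp_lsc n (fun l => ξ k - ξ l) _ (hξ'.const_sub _)).trans ?_⟩
    exact liminf_le_of_frequently_le'
      ((eventually_ge_atTop N).mono fun l hl => hN k hk l hl).frequently
  refine ⟨ξ', fun n => ?_, fun n => ENNReal.tendsto_atTop_zero.2 fun ε hε => hle n ε hε⟩
  obtain ⟨N, hN⟩ := hle n 1 one_pos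
  calc p n ξ' = p n (ξ N + (-1 : ℝ) • (ξ N - ξ')) := by congr 1; module
    _ ≤ p n (ξ N) + p n (ξ N - ξ') := by
      refine (hp_sub n _ _).trans_eq ?_
      rw [hp_hom, abs_neg, abs_one, ofReal_one, one_mul]
    _ < ⊤ := ENNReal.add_lt_top.2 ⟨hmem N n, (hN N le_rfl).trans_lt one_lt_top⟩
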